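/- Let (δ_n), (h_n) be real sequences with h_n ≠ 0 for all n, let (γ_n) be strictly positive, and set ζ_n = h_n/γ_n. Suppose that either (1) the sequence (ζ_n) does not converge to zero, or (2) ζ_n → 0 and ∑_n |ζ_n|^m = ∞ for some natural number m ≥ 2. Then the infinite product measures ⊗_{n∈ℕ} μ(δ_n, γ_n) and ⊗_{n∈ℕ} μ(δ_n + h_n, γ_n) on ℝ^ℕ are mutually singular. -/

import Mathlib

open MeasureTheory Real Filter

/-- The Cauchy measure on `ℝ` with location parameter `δ` and scale parameter `γ`. -/
noncomputable def cauchyMeasure (δ γ : ℝ) : Measure ℝ :=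
  volume.withDensity fun x => ENNReal.ofReal (γ / (π * ((x - δ) ^ 2 + γ ^ 2)))

lemma cauchyMeasure_eq_probabilityTheory_cauchyMeasure (δ : ℝ) {γ : ℝ} (hγ : 0 < γ) :
    cauchyMeasure δ γ = ProbabilityTheory.cauchyMeasure δ γ.toNNReal := by
  rw [ProbabilityTheory.cauchyMeasure_of_scale_ne_zero _ (toNNReal_pos.mpr hγ).ne', cauchyMeasure]
  congr 1
  ext x
  rw [ProbabilityTheory.cauchyPDF_def, ProbabilityTheory.cauchyPDFReal_def,
    coe_toNNReal _ hγ.le]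
  field_simp

lemma isProbabilityMeasure_cauchyMeasure (δ : ℝ) {γ : ℝ} (hγ : 0 < γ) :
    IsProbabilityMeasure (cauchyMeasure δ γ) := by
  rw [cauchyMeasure_eq_probabilityTheory_cauchyMeasure δ hγ]
  infer_instance

lemma cauchyMeasure_real_Ioi (δ t : ℝ) {γ : ℝ} (hγ : 0 < γ) :
    (cauchyMeasure δ γ).real (Set.Ioi t) = 1 / 2 - arctan ((t - δ) / γ) / π := by
  have hderiv (x : ℝ) : HasDerivAt (fun y => arctan ((y - δ) / γ) / π)
      (γ / (π * ((x - δ) ^ 2 + γ ^ 2))) x := by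
    refine (((((hasDerivAt_id x).sub_const δ).div_const γ).arctan).div_const π).congr_deriv ?_
    have : (x - δ) ^ 2 + γ ^ 2 ≠ 0 := by positivity
    simp only [id]
    field_simp
    ring
  have hnonneg (x : ℝ) : 0 ≤ γ / (π * ((x - δ) ^ 2 + γ ^ 2)) := by positivity
  have htop : Tendsto (fun y => arctan ((y - δ) / γ) / π) atTop (nhds (π / 2 / π)) := by
    refine ((tendsto_nhds_of_tendsto_nhdsWithin tendsto_arctan_atTop).comp ?_).div_const π
    exact (tendsto_atTop_add_const_right _ (-δ) tendsto_id).atTop_div_const hγ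
  have hint := integrableOn_Ioi_deriv_of_nonneg' (a := t) (fun x _ => hderiv x)
    (fun x _ => hnonneg x) htop
  have hval := integral_Ioi_of_hasDerivAt_of_nonneg' (a := t) (fun x _ => hderiv x)
    (fun x _ => hnonneg x) htop
  rw [measureReal_def, cauchyMeasure, withDensity_apply _ measurableSet_Ioi,
    ← integral_eq_lintegral_of_nonneg_ae (ae_of_all _ hnonneg) hint.aestronglyMeasurable, hval]
  field_simp

/-- Measures separated by a sequence of events, with errors tending to zero, are mutually
singular. -/
lemma mutuallySingular_of_tendsto_measure {Ω : Type*} [MeasurableSpace Ω] {P Q : Measure Ω}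
    [IsFiniteMeasure P] [IsFiniteMeasure Q] (E : ℕ → Set Ω)
    (hP : Tendsto (fun n => P (E n)) atTop (nhds 0))
    (hQ : Tendsto (fun n => Q (E n)ᶜ) atTop (nhds 0)) : P.MutuallySingular Q := by
  refine Measure.mutuallySingular_of_disjoint fun ξ hξP hξQ => ?_
  suffices ξ Set.univ ≤ 0 by
    rw [Measure.measure_univ_eq_zero.mp (le_antisymm this (zero_le))]
    exact bot_le
  have h := hP.add hQ
  rw [add_zero] at h
  refine ge_of_tendsto' h fun n => ?_
  rw [← Set.union_compl_self (E n)]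
  exact (measure_union_le _ _).trans (add_le_add (hξP _) (hξQ _))

/-- Chebyshev's inequality for a weighted count of independent events. -/
lemma infinitePi_deviation_le (ν : ℕ → Measure ℝ) [∀ n, IsProbabilityMeasure (ν n)]
    (s : ℕ → Set ℝ) (hs : ∀ n, MeasurableSet (s n)) (a : ℕ → ℝ) (N : ℕ) {c : ℝ} (hc : 0 < c) :
    Measure.infinitePi ν {ω | c ≤ |∑ n ∈ Finset.range N, (s n).indicator (fun _ => a n) (ω n)
      - ∑ n ∈ Finset.range N, a n * (ν n).real (s n)|} ≤
      ENNReal.ofReal ((∑ n ∈ Finset.range N, a n ^ 2) / c ^ 2) := by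
  let X (n : ℕ) (ω : ℕ → ℝ) : ℝ := (s n).indicator (fun _ => a n) (ω n)
  have hm (n : ℕ) : Measurable ((s n).indicator fun _ => a n) :=
    measurable_const.indicator (hs n)
  have hmX (n : ℕ) : Measurable (X n) := (hm n).comp (measurable_pi_apply n)
  have hX (n : ℕ) : MemLp (X n) 2 (Measure.infinitePi ν) := by
    refine MemLp.of_bound (hmX n).aestronglyMeasurable |a n| (ae_of_all _ fun ω => ?_)
    exact norm_indicator_le_norm_self (fun _ => a n) (ω n)
  have hmean (n : ℕ) : ∫ ω, X n ω ∂(Measure.infinitePi ν) = a n * (ν n).real (s n) := by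
    have h := integral_map (μ := Measure.infinitePi ν) (measurable_pi_apply n).aemeasurable
      (hm n).aestronglyMeasurable
    rw [Measure.infinitePi_map_eval] at h
    rw [← h, integral_indicator_const _ (hs n), smul_eq_mul, mul_comm]
  have hvar (n : ℕ) : ProbabilityTheory.variance (X n) (Measure.infinitePi ν) ≤ a n ^ 2 := by
    refine (ProbabilityTheory.variance_le_expectation_sq (hmX n).aestronglyMeasurable).trans ?_
    refine (integral_mono (hX n).integrable_sq (integrable_const (a n ^ 2)) fun ω => ?_).trans
      (by simp)
    exact sq_le_sq.mpr (norm_indicator_le_norm_self (fun _ => a n) (ω n))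
  have hsum : MemLp (∑ n ∈ Finset.range N, X n) 2 (Measure.infinitePi ν) :=
    memLp_finsetSum' _ fun n _ => hX n
  have hind := ProbabilityTheory.iIndepFun_infinitePi (P := ν) hm
  have hcheb := ProbabilityTheory.meas_ge_le_variance_div_sq hsum hc
  rw [ProbabilityTheory.IndepFun.variance_sum (fun n _ => hX n)
    fun i _ j _ hij => hind.indepFun hij] at hcheb
  simp only [Finset.sum_apply] at hcheb
  rw [integral_finsetSum _ fun n _ => (hX n).integrable one_le_two] at hcheb
  simp only [hmean] at hcheb
  refine hcheb.trans (ENNReal.ofReal_le_ofReal ?_)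
  gcongr with n
  exact hvar n

/-- Infinite products are mutually singular as soon as the probabilities of some events on the
factors have differences that are not square summable. -/
lemma infinitePi_mutuallySingular (μ ν : ℕ → Measure ℝ) [∀ n, IsProbabilityMeasure (μ n)]
    [∀ n, IsProbabilityMeasure (ν n)] (s : ℕ → Set ℝ) (hs : ∀ n, MeasurableSet (s n))
    (h : ¬ Summable fun n => ((ν n).real (s n) - (μ n).real (s n)) ^ 2) :
    (Measure.infinitePi μ).MutuallySingular (Measure.infinitePi ν) := by
  set a : ℕ → ℝ := fun n => (ν n).real (s n) - (μ n).real (s n) with ha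
  let A (N : ℕ) : ℝ := ∑ n ∈ Finset.range N, a n ^ 2
  have hA : Tendsto A atTop atTop :=
    (not_summable_iff_tendsto_nat_atTop_of_nonneg fun n => sq_nonneg _).mp h
  have hlim : Tendsto (fun N => ENNReal.ofReal (A N / (A N / 2) ^ 2)) atTop (nhds 0) := by
    rw [← ENNReal.ofReal_zero]
    refine ENNReal.tendsto_ofReal ((hA.const_div_atTop 4).congr' ?_)
    filter_upwards [hA.eventually_gt_atTop 0] with N hN
    field_simp
    norm_num
  let S (N : ℕ) (ω : ℕ → ℝ) : ℝ :=
    ∑ n ∈ Finset.range N, (s n).indicator (fun _ => a n) (ω n)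
  let m (N : ℕ) : ℝ := ∑ n ∈ Finset.range N, a n * (μ n).real (s n)
  refine mutuallySingular_of_tendsto_measure (fun N => {ω | A N / 2 ≤ |S N ω - m N|}) ?_ ?_
  · refine tendsto_of_tendsto_of_tendsto_of_le_of_le' tendsto_const_nhds hlim
      (Eventually.of_forall fun _ => zero_le) ?_
    filter_upwards [hA.eventually_gt_atTop 0] with N hN
    exact infinitePi_deviation_le μ s hs a N (half_pos hN)
  · refine tendsto_of_tendsto_of_tendsto_of_le_of_le' tendsto_const_nhds hlim
      (Eventually.of_forall fun _ => zero_le) ?_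
    filter_upwards [hA.eventually_gt_atTop 0] with N hN
    refine (measure_mono fun ω hω => ?_).trans
      (infinitePi_deviation_le ν s hs a N (half_pos hN))
    have hmean : ∑ n ∈ Finset.range N, a n * (ν n).real (s n) = m N + A N := by
      rw [← Finset.sum_add_distrib]
      exact Finset.sum_congr rfl fun n _ => by simp only [ha]; ring
    simp only [Set.mem_compl_iff, Set.mem_ofPred_eq, not_le, abs_lt] at hω
    rw [Set.mem_ofPred_eq, hmean, le_abs]
    right
    change A N / 2 ≤ -(S N ω - (m N + A N))
    linarith [hω.2]

lemma isBigO_arctan_of_tendsto_zero {ζ : ℕ → ℝ} (h : Tendsto ζ atTop (nhds 0)) :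
    ζ =O[atTop] fun n => arctan (ζ n) := by
  have htan : (fun x : ℝ => tan x) =O[nhds 0] fun x => x := by
    simpa using (hasDerivAt_tan (x := 0) (by simp)).differentiableAt.isBigO_sub
  have harctan : Tendsto (fun n => arctan (ζ n)) atTop (nhds 0) := by
    simpa [Function.comp_def] using (continuous_arctan.tendsto 0).comp h
  simpa [Function.comp_def, tan_arctan] using htan.comp_tendsto harctan

lemma tendsto_zero_of_summable_arctan_sq {ζ : ℕ → ℝ}
    (h : Summable fun n => arctan (ζ n) ^ 2) : Tendsto ζ atTop (nhds 0) := by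
  have harctan : Tendsto (fun n => arctan (ζ n)) atTop (nhds 0) := by
    have h' := h.tendsto_atTop_zero
    rw [tendsto_zero_iff_abs_tendsto_zero]
    simpa [Function.comp_def, sqrt_sq_eq_abs] using (continuous_sqrt.tendsto 0).comp h'
  have htan : Tendsto tan (nhds 0) (nhds 0) := by
    simpa using (continuousAt_tan.mpr (by simp : cos 0 ≠ 0)).tendsto
  simpa [Function.comp_def, tan_arctan] using htan.comp harctan

lemma summable_abs_pow_of_summable_arctan_sq {ζ : ℕ → ℝ}
    (h : Summable fun n => arctan (ζ n) ^ 2) {m : ℕ} (hm : 2 ≤ m) :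
    Summable fun n => |ζ n| ^ m := by
  have hζ := tendsto_zero_of_summable_arctan_sq h
  have hsq : Summable fun n => ζ n ^ 2 :=
    summable_of_isBigO_nat h ((isBigO_arctan_of_tendsto_zero hζ).pow 2)
  refine summable_of_isBigO_nat hsq (Asymptotics.IsBigO.of_bound 1 ?_)
  filter_upwards [hζ.abs.eventually_le_const (by simp : |(0 : ℝ)| < 1)] with n hn
  rw [one_mul, norm_pow, norm_pow, norm_eq_abs, norm_eq_abs, abs_abs]
  exact pow_le_pow_of_le_one (abs_nonneg _) hn hm

theorem cauchy_product_mutually_singular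
    (δ h γ : ℕ → ℝ) (hh : ∀ n, h n ≠ 0) (hγ : ∀ n, 0 < γ n)
    (P Q : Measure (ℕ → ℝ))
    (hP : IsProjectiveLimit P fun I : Finset ℕ =>
      Measure.pi fun i : I => cauchyMeasure (δ i.1) (γ i.1))
    (hQ : IsProjectiveLimit Q fun I : Finset ℕ =>
      Measure.pi fun i : I => cauchyMeasure (δ i.1 + h i.1) (γ i.1))
    (hcond : ¬ Tendsto (fun n => h n / γ n) atTop (nhds 0) ∨
      (Tendsto (fun n => h n / γ n) atTop (nhds 0) ∧
        ∃ m : ℕ, 2 ≤ m ∧ ¬ Summable fun n => |h n / γ n| ^ m)) :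
    P.MutuallySingular Q := by
  have _ (n : ℕ) := isProbabilityMeasure_cauchyMeasure (δ n) (hγ n)
  have _ (n : ℕ) := isProbabilityMeasure_cauchyMeasure (δ n + h n) (hγ n)
  rw [hP.unique (Measure.isProjectiveLimit_infinitePi fun n => cauchyMeasure (δ n) (γ n)),
    hQ.unique (Measure.isProjectiveLimit_infinitePi fun n => cauchyMeasure (δ n + h n) (γ n))]
  refine infinitePi_mutuallySingular _ _ (fun n => Set.Ioi (δ n)) (fun _ => measurableSet_Ioi)
    fun hsum => ?_
  have hdiff (n : ℕ) : ((cauchyMeasure (δ n + h n) (γ n)).real (Set.Ioi (δ n)) -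
      (cauchyMeasure (δ n) (γ n)).real (Set.Ioi (δ n))) ^ 2 =
      arctan (h n / γ n) ^ 2 / π ^ 2 := by
    rw [cauchyMeasure_real_Ioi _ _ (hγ n), cauchyMeasure_real_Ioi _ _ (hγ n), sub_self, zero_div,
      arctan_zero, sub_add_cancel_left, neg_div, arctan_neg]
    ring
  simp only [hdiff] at hsum
  have harctan : Summable fun n => arctan (h n / γ n) ^ 2 := by
    exact (summable_div_const_iff (pow_ne_zero 2 pi_ne_zero)).mp hsum
  rcases hcond with hlim | ⟨-, m, hm, hsumm⟩
  · exact hlim (tendsto_zero_of_summable_arctan_sq harctan)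
  · exact hsumm (summable_abs_pow_of_summable_arctan_sq harctan hm)
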